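/- arXiv:2006.01240 — 2 statements merged into one kernel-verified Lean document; each statement's English description precedes it below -/
import Mathlib

section
/- For every k ≥ 2, n ≥ 1, and every symbol α of desc(n, k−1), the set U_α is an open and convex subset of ℝ^n. -/
/-- A symbol on the index set `Fin n`: a finite sequence of nonempty blocks in
which every index appears exactly once.  We encode this by requiring the
concatenation (flatten) of the blocks to be a permutation of the list of all
indices. -/
def IsSymbolF (n : ℕ) (L : List (List (Fin n))) : Prop :=
  (∀ b ∈ L, b ≠ []) ∧ L.flatten.Perm (List.finRange n)

/-- The `i`-th block (0-indexed); junk value `[]` if out of range. -/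
def fblockF {n : ℕ} (L : List (List (Fin n))) (i : ℕ) : List (Fin n) := L.getD i []

/-- desc(n,w): symbols all of whose blocks have at most `w` elements and in
which the entries of every block are strictly decreasing. -/
def IsDescF (n w : ℕ) (L : List (List (Fin n))) : Prop :=
  IsSymbolF n L ∧ ∀ b ∈ L, b.length ≤ w ∧ b.Chain' (· > ·)

/-- The open set U_α ⊆ ℝ^n attached to a symbol α:
(i) whenever `a` and `b` lie in different blocks with `a`'s block earlier, `x a < x b`;
(ii) whenever `a, b` lie in a common block and `a', b'` lie in two different
blocks, `|x a − x b| < |x a' − x b'|`. -/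
def UA {n : ℕ} (L : List (List (Fin n))) : Set (Fin n → ℝ) :=
  {x | (∀ i j : ℕ, i < j → j < L.length →
          ∀ a ∈ fblockF L i, ∀ b ∈ fblockF L j, x a < x b) ∧
       (∀ b ∈ L, ∀ p ∈ b, ∀ q ∈ b,
          ∀ i j : ℕ, i < L.length → j < L.length → i ≠ j →
            ∀ p' ∈ fblockF L i, ∀ q' ∈ fblockF L j,
              |x p - x q| < |x p' - x q'|)}

/-- The no-k-equal space: points of ℝ^n such that no k of the coordinates are
equal, i.e. for every k-element set of indices the corresponding coordinates
are not all equal. -/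
def noK (n k : ℕ) : Set (Fin n → ℝ) :=
  {x | ∀ S : Finset (Fin n), S.card = k → ¬ ∀ a ∈ S, ∀ b ∈ S, x a = x b}

/-- `a` lies in a strictly earlier block of `L` than `b`. -/
def InEarlierBlock {n : ℕ} (L : List (List (Fin n))) (a b : Fin n) : Prop :=
  ∃ i j : ℕ, i < j ∧ j < L.length ∧ a ∈ fblockF L i ∧ b ∈ fblockF L j

/-- Since `x` increases along the blocks, the distance between entries of different blocks is a
linear function of `x` on `UA L`. -/
theorem mem_UA_iff {n : ℕ} (L : List (List (Fin n))) (x : Fin n → ℝ) :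
    x ∈ UA L ↔ ∀ a b, InEarlierBlock L a b → x a < x b ∧
      ∀ p q, (∃ c ∈ L, p ∈ c ∧ q ∈ c) → |x p - x q| < x b - x a := by
  constructor
  · rintro ⟨h₁, h₂⟩ a b ⟨i, j, hij, hj, ha, hb⟩
    have hab := h₁ i j hij hj a ha b hb
    refine ⟨hab, ?_⟩
    rintro p q ⟨c, hc, hp, hq⟩
    have h := h₂ c hc p hp q hq j i hj (hij.trans hj) hij.ne' b hb a ha
    rwa [abs_of_pos (sub_pos.2 hab)] at h
  · intro h
    refine ⟨fun i j hij hj a ha b hb => (h a b ⟨i, j, hij, hj, ha, hb⟩).1, ?_⟩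
    intro c hc p hp q hq i j hi hj hij a ha b hb
    rcases hij.lt_or_gt with hlt | hlt
    · have hab := (h a b ⟨i, j, hlt, hj, ha, hb⟩).2 p q ⟨c, hc, hp, hq⟩
      rw [abs_sub_comm (x a)]
      exact hab.trans_le (le_abs_self _)
    · have hab := (h b a ⟨j, i, hlt, hi, hb, ha⟩).2 p q ⟨c, hc, hp, hq⟩
      exact hab.trans_le (le_abs_self _)

theorem isOpen_UA {n : ℕ} (L : List (List (Fin n))) : IsOpen (UA L) := by
  have h : UA L = {x | ∀ a b, InEarlierBlock L a b → x a < x b ∧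
      ∀ p q, (∃ c ∈ L, p ∈ c ∧ q ∈ c) → |x p - x q| < x b - x a} := by
    ext x
    exact mem_UA_iff L x
  rw [h]
  simp only [Set.ofPred_forall, Set.ofPred_and]
  refine isOpen_iInter_of_finite fun a => isOpen_iInter_of_finite fun b =>
    isOpen_iInter_of_finite fun _ => (isOpen_lt (by fun_prop) (by fun_prop)).inter ?_
  exact isOpen_iInter_of_finite fun p => isOpen_iInter_of_finite fun q =>
    isOpen_iInter_of_finite fun _ => isOpen_lt (by fun_prop) (by fun_prop)

theorem convex_UA {n : ℕ} (L : List (List (Fin n))) : Convex ℝ (UA L) := by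
  rw [convex_iff_forall_pos]
  intro x hx y hy s t hs ht _
  rw [mem_UA_iff] at hx hy ⊢
  intro a b hab
  obtain ⟨hxab, hx⟩ := hx a b hab
  obtain ⟨hyab, hy⟩ := hy a b hab
  simp only [Pi.add_apply, Pi.smul_apply, smul_eq_mul]
  refine ⟨by gcongr, fun p q hpq => ?_⟩
  calc |s * x p + t * y p - (s * x q + t * y q)|
      = |s * (x p - x q) + t * (y p - y q)| := by congr 1; ring
    _ ≤ s * |x p - x q| + t * |y p - y q| := by
      refine (abs_add_le _ _).trans_eq ?_
      rw [abs_mul, abs_mul, abs_of_pos hs, abs_of_pos ht]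
    _ < s * (x b - x a) + t * (y b - y a) := by
      gcongr
      exacts [hx p q hpq, hy p q hpq]
    _ = s * x b + t * y b - (s * x a + t * y a) := by ring

/-!
STATEMENT 7: For every k ≥ 2, n ≥ 1, and every symbol α of desc(n, k−1), the
set U_α is an open and convex subset of ℝ^n.
-/

theorem stmt7 (k n : ℕ) (hk : 2 ≤ k) (hn : 1 ≤ n)
    (α : List (List (Fin n))) (hα : IsDescF n (k - 1) α) :
    IsOpen (UA α) ∧ Convex ℝ (UA α) :=
  ⟨isOpen_UA α, convex_UA α⟩
end

section
/- Let ≺ be an admissible linear order on the symbols on {1,…,n}, and consider the induced discrete vector field on cell(n,2). Then every critical symbol e of cell(n,2) satisfies: (1) whenever two consecutive blocks of e are both singletons, their entries are in decreasing order; and (2) every 2-element block of e whose entries are in decreasing order is a follower. -/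
/-- A symbol on {1,…,n}: a finite sequence of nonempty blocks in which every
element of {1,…,n} appears exactly once.  We encode the condition "each block
is nonempty and each element of {1,…,n} appears exactly once among all blocks"
by requiring the concatenation (flatten) of the blocks to be a permutation of the
list [1, 2, …, n]. -/
def IsSymbolOn (n : ℕ) (L : List (List ℕ)) : Prop :=
  (∀ b ∈ L, b ≠ []) ∧ L.flatten.Perm (List.range' 1 n)

/-- The symbols on {1,…,n}. -/
def SymbolOn (n : ℕ) : Type := {L : List (List ℕ) // IsSymbolOn n L}

/-- The `i`-th block (0-indexed) of a list of blocks; junk value `[]` if out of range. -/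
def fblock (L : List (List ℕ)) (i : ℕ) : List ℕ := L.getD i []

/-- The `i`-th block of `L` is a follower: the preceding block is a singleton whose
element is less than every element of block `i`. -/
def IsFollower (L : List (List ℕ)) (i : ℕ) : Prop :=
  ∃ j, i = j + 1 ∧ ∃ a, fblock L j = [a] ∧ ∀ x ∈ fblock L i, a < x

/-- The first element of a block (junk value `0` for the empty list). -/
def headL (l : List ℕ) : ℕ := l.headD 0

/-- A relation `r` on the symbols on {1,…,n} is admissible if, whenever symbols α and β
agree in blocks `0,…,i-1` and differ in block `i`, conditions (1)–(4) hold. -/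
def Admissible (n : ℕ) (r : SymbolOn n → SymbolOn n → Prop) : Prop :=
  ∀ α β : SymbolOn n, ∀ i : ℕ,
    (∀ k < i, fblock α.1 k = fblock β.1 k) → fblock α.1 i ≠ fblock β.1 i →
      ((IsFollower α.1 i → IsFollower β.1 i →
          (fblock α.1 i).length < (fblock β.1 i).length → r α β) ∧
       (¬IsFollower α.1 i → ¬IsFollower β.1 i →
          headL (fblock β.1 i) < headL (fblock α.1 i) → r α β) ∧
       (¬IsFollower α.1 i → ¬IsFollower β.1 i →
          headL (fblock α.1 i) = headL (fblock β.1 i) →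
          (fblock α.1 i).length < (fblock β.1 i).length → r α β) ∧
       (IsFollower α.1 i → ¬IsFollower β.1 i → r α β))

/-- `l` is a shuffle of `A` and `B`: an interleaving of the two sequences that
preserves the relative order of the entries of `A` and of the entries of `B`.
(For lists with no duplicate entries this is equivalent to: `A` and `B` are both
subsequences of `l` and the concatenation `A ++ B` is a permutation of `l`.) -/
def IsShuffle (A B l : List ℕ) : Prop :=
  A.Sublist l ∧ B.Sublist l ∧ (A ++ B).Perm l

/-- `f` is a face of `g`: `g` is obtained from `f` by replacing two consecutive
blocks `A`, `B` of `f` by a single block which is a shuffle of `A` and `B`. -/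
def IsFaceL (f g : List (List ℕ)) : Prop :=
  ∃ k, k < g.length ∧ ∃ A B,
    f = g.take k ++ [A, B] ++ g.drop (k + 1) ∧ IsShuffle A B (fblock g k)

/-- Given a linear order `r` and a set `X` of symbols closed under faces, the
induced discrete vector field pairs `f` with `g` exactly when `f` is the
`r`-greatest face of `g` and `g` is the `r`-least coface of `f` among cofaces
of `f` lying in `X`. -/
def Paired (n : ℕ) (r : SymbolOn n → SymbolOn n → Prop) (X : Set (SymbolOn n))
    (f g : SymbolOn n) : Prop :=
  f ∈ X ∧ g ∈ X ∧ IsFaceL f.1 g.1 ∧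
    (∀ f' : SymbolOn n, IsFaceL f'.1 g.1 → f' = f ∨ r f' f) ∧
    (∀ g' : SymbolOn n, g' ∈ X → IsFaceL f.1 g'.1 → g' = g ∨ r g g')

/-- A symbol of `X` is critical if it belongs to no pair of the induced
discrete vector field. -/
def Critical (n : ℕ) (r : SymbolOn n → SymbolOn n → Prop) (X : Set (SymbolOn n))
    (e : SymbolOn n) : Prop :=
  e ∈ X ∧ (∀ g, ¬ Paired n r X e g) ∧ (∀ f, ¬ Paired n r X f e)

/-- The symbols of cell(n,w): all blocks have at most `w` elements. -/
def cellSet (n w : ℕ) : Set (SymbolOn n) := {e | ∀ b ∈ e.1, b.length ≤ w}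

/-- The symbols of desc(n,w): all blocks have at most `w` elements and the
entries of every block are strictly decreasing. -/
def descSet (n w : ℕ) : Set (SymbolOn n) :=
  {e | ∀ b ∈ e.1, b.length ≤ w ∧ b.Chain' (· > ·)}

/-!
STATEMENT 10: Let ≺ be an admissible linear order on the symbols on {1,…,n},
and consider the induced discrete vector field on cell(n,2).  Then every
critical symbol e of cell(n,2) satisfies: (1) whenever two consecutive blocks
of e are both singletons, their entries are in decreasing order; and (2) every
2-element block of e whose entries are in decreasing order is a follower.
-/

theorem fblock_append_of_lt {P : List (List ℕ)} (R : List (List ℕ)) {m : ℕ}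
    (h : m < P.length) : fblock (P ++ R) m = fblock P m :=
  List.getD_append _ _ _ _ h

theorem fblock_append_add (P R : List (List ℕ)) (m : ℕ) :
    fblock (P ++ R) (P.length + m) = fblock R m := by
  rw [fblock, List.getD_append_right _ _ _ _ (Nat.le_add_right _ _), Nat.add_sub_cancel_left, fblock]

theorem fblock_append_length (P : List (List ℕ)) (A : List ℕ) (R : List (List ℕ)) :
    fblock (P ++ A :: R) P.length = A :=
  fblock_append_add P (A :: R) 0

theorem fblock_append_length_succ (P : List (List ℕ)) (A B : List ℕ) (R : List (List ℕ)) :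
    fblock (P ++ A :: B :: R) (P.length + 1) = B :=
  fblock_append_add P (A :: B :: R) 1

theorem lt_length_of_fblock_ne_nil {L : List (List ℕ)} {i : ℕ} (h : fblock L i ≠ []) :
    i < L.length := by
  by_contra hi
  exact h (List.getD_eq_default _ _ (not_lt.mp hi))

theorem drop_eq_fblock_cons {L : List (List ℕ)} {i : ℕ} (h : i < L.length) :
    L.drop i = fblock L i :: L.drop (i + 1) := by
  rw [List.drop_eq_getElem_cons h, fblock, List.getD_eq_getElem _ _ h]

theorem exists_eq_append_of_fblock_ne_nil {L : List (List ℕ)} {i : ℕ} (h : fblock L i ≠ []) :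
    ∃ P Q, P.length = i ∧ L = P ++ fblock L i :: Q := by
  have hi := lt_length_of_fblock_ne_nil h
  refine ⟨L.take i, L.drop (i + 1), by simp [hi.le], ?_⟩
  rw [← drop_eq_fblock_cons hi, List.take_append_drop]

theorem isFollower_congr {L M : List (List ℕ)} {i : ℕ}
    (h : ∀ m ≤ i, fblock L m = fblock M m) : IsFollower L i ↔ IsFollower M i := by
  unfold IsFollower
  constructor <;> rintro ⟨j, rfl, a, ha, hx⟩ <;> refine ⟨j, rfl, a, ?_, ?_⟩
  · rw [← h j (by omega), ha]
  · rwa [← h _ le_rfl]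
  · rw [h j (by omega), ha]
  · rwa [h _ le_rfl]

theorem IsFollower.of_subset {L M : List (List ℕ)} {i : ℕ} (hL : IsFollower L i)
    (h : ∀ m < i, fblock L m = fblock M m) (hs : ∀ x ∈ fblock M i, x ∈ fblock L i) :
    IsFollower M i := by
  obtain ⟨j, rfl, a, ha, hx⟩ := hL
  exact ⟨j, rfl, a, by rw [← h j (by omega), ha], fun x hx' => hx x (hs x hx')⟩

/-- A face of a symbol all of whose blocks have at most two elements arises by splitting
a block with two elements into two singletons. -/
theorem IsFaceL.exists_split {f g : List (List ℕ)} (h : IsFaceL f g)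
    (hf : ∀ b ∈ f, b ≠ []) (hg : ∀ b ∈ g, b.length ≤ 2) :
    ∃ P Q x y l, f = P ++ [x] :: [y] :: Q ∧ g = P ++ l :: Q ∧ (l = [x, y] ∨ l = [y, x]) := by
  obtain ⟨k, hk, A, B, rfl, -, -, hp⟩ := h
  have hA : A ≠ [] := hf A (by simp)
  have hB : B ≠ [] := hf B (by simp)
  have hmem : fblock g k ∈ g := by
    rw [fblock, List.getD_eq_getElem _ _ hk]
    exact List.getElem_mem hk
  have hlen := hp.length_eq
  have h2 := hg _ hmem
  have hA' := List.length_pos_iff.mpr hA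
  have hB' := List.length_pos_iff.mpr hB
  rw [List.length_append] at hlen
  obtain ⟨x, rfl⟩ := List.length_eq_one_iff.mp (show A.length = 1 by omega)
  obtain ⟨y, rfl⟩ := List.length_eq_one_iff.mp (show B.length = 1 by omega)
  refine ⟨g.take k, g.drop (k + 1), x, y, fblock g k, by simp, ?_, ?_⟩
  · rw [← drop_eq_fblock_cons hk, List.take_append_drop]
  · obtain ⟨u, v, huv⟩ := List.length_eq_two.mp
      (show (fblock g k).length = 2 by simpa using hlen.symm)
    rw [huv] at hp ⊢
    have hx : x ∈ [u, v] := hp.subset (by simp)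
    rcases List.mem_pair.mp hx with rfl | rfl
    · have := hp.cons_inv
      simp at this
      simp [this]
    · have := (hp.trans (List.Perm.swap _ _ _)).cons_inv
      simp at this
      simp [this]

theorem isFaceL_append (P Q : List (List ℕ)) (a b : ℕ) :
    IsFaceL (P ++ [a] :: [b] :: Q) (P ++ [b, a] :: Q) := by
  refine ⟨P.length, by simp, [a], [b], ?_, ?_⟩
  · simp [List.drop_append]
  · rw [fblock_append_length]
    exact ⟨by simp, by simp, List.Perm.swap _ _ _⟩

theorem isSymbolOn_append_iff (n : ℕ) (P Q : List (List ℕ)) (a b : ℕ) :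
    IsSymbolOn n (P ++ [a] :: [b] :: Q) ↔ IsSymbolOn n (P ++ [b, a] :: Q) := by
  have hp : (P ++ [a] :: [b] :: Q).flatten.Perm (P ++ [b, a] :: Q).flatten := by
    simpa using (List.Perm.swap b a Q.flatten).append_left P.flatten
  refine and_congr ?_ ⟨hp.symm.trans, hp.trans⟩
  simp [or_imp, forall_and]

theorem SymbolOn.ne_of_eq_append_singletons {n : ℕ} (e : SymbolOn n) {a b : ℕ}
    {P Q : List (List ℕ)} (h : e.1 = P ++ [a] :: [b] :: Q) : a ≠ b := by
  have hnd := e.2.2.nodup_iff.mpr List.nodup_range'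
  rw [h] at hnd
  rintro rfl
  simp [List.nodup_append] at hnd

namespace Admissible

variable {n : ℕ} {r : SymbolOn n → SymbolOn n → Prop}

theorem rel_of_singleton_pair (h : Admissible n r) {α β : SymbolOn n} {i x y z : ℕ}
    (heq : ∀ k < i, fblock α.1 k = fblock β.1 k) (hα : fblock α.1 i = [z])
    (hβ : fblock β.1 i = [x, y]) (hz : z = x ∨ z = y) (hx : IsFollower β.1 i ∨ x ≤ z) :
    r α β := by
  obtain ⟨h1, h2, h3, h4⟩ := h α β i heq (by simp [hα, hβ])
  by_cases hfβ : IsFollower β.1 i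
  · exact h1 (hfβ.of_subset (fun m hm => (heq m hm).symm) (by simpa [hα, hβ] using hz)) hfβ
      (by simp [hα, hβ])
  by_cases hfα : IsFollower α.1 i
  · exact h4 hfα hfβ
  rcases (hx.resolve_left hfβ).lt_or_eq with hlt | rfl
  · exact h2 hfα hfβ (by simpa [hα, hβ, headL] using hlt)
  · exact h3 hfα hfβ (by simp [hα, hβ, headL]) (by simp [hα, hβ])

theorem rel_of_head_lt (h : Admissible n r) {α β : SymbolOn n} {i : ℕ}
    (heq : ∀ k < i, fblock α.1 k = fblock β.1 k) (hβ : ¬IsFollower β.1 i)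
    (hlt : headL (fblock β.1 i) < headL (fblock α.1 i)) : r α β := by
  obtain ⟨-, h2, -, h4⟩ := h α β i heq (fun he => by simp [he] at hlt)
  by_cases hfα : IsFollower α.1 i
  · exact h4 hfα hβ
  · exact h2 hfα hβ hlt

/-- Splitting the first non-follower decreasing pair `[b, a]` into `[a], [b]`, where no two
earlier consecutive singletons increase, gives a pair of the induced vector field. -/
theorem paired (h : Admissible n r) {f g : SymbolOn n} {P Q : List (List ℕ)} {a b : ℕ}
    (hab : a < b) (hf : f.1 = P ++ [a] :: [b] :: Q) (hg : g.1 = P ++ [b, a] :: Q)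
    (hfX : f ∈ cellSet n 2) (hgX : g ∈ cellSet n 2) (hgn : ¬IsFollower g.1 P.length)
    (hsing : ∀ k x y, k + 1 < P.length → fblock P k = [x] → fblock P (k + 1) = [y] → y ≤ x)
    (hpair : ∀ k x y, k < P.length → fblock P k = [x, y] → y < x → IsFollower P k) :
    Paired n r (cellSet n 2) f g := by
  have hfP : ∀ m < P.length, fblock f.1 m = fblock P m := fun m hm => by
    rw [hf, fblock_append_of_lt _ hm]
  have hgP : ∀ m < P.length, fblock g.1 m = fblock P m := fun m hm => by
    rw [hg, fblock_append_of_lt _ hm]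
  have hfi : fblock f.1 P.length = [a] := by rw [hf, fblock_append_length]
  have hfi' : fblock f.1 (P.length + 1) = [b] := by rw [hf, fblock_append_length_succ]
  have hgi : fblock g.1 P.length = [b, a] := by rw [hg, fblock_append_length]
  have hlast : ∀ j x, j + 1 = P.length → fblock P j = [x] → a ≤ x := by
    intro j x hj hx
    by_contra hlt
    refine hgn ⟨j, hj.symm, x, by rw [hgP j (by omega), hx], ?_⟩
    rw [hgi]
    simp
    omega
  have hfn : ¬IsFollower f.1 P.length := by
    rintro ⟨j, hj, x, hx, hlt⟩
    rw [hfP j (by omega)] at hx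
    rw [hfi] at hlt
    exact absurd (hlt a (by simp)) (not_lt.mpr (hlast j x hj.symm hx))
  refine ⟨hfX, hgX, by rw [hf, hg]; exact isFaceL_append P Q a b, ?_, ?_⟩
  · intro f' hface
    obtain ⟨P', Q', x, y, l, hf', hg', hl⟩ := hface.exists_split f'.2.1 hgX
    have hf'P : ∀ m < P'.length, fblock f'.1 m = fblock g.1 m := fun m hm => by
      rw [hf', hg', fblock_append_of_lt _ hm, fblock_append_of_lt _ hm]
    have hf'i : fblock f'.1 P'.length = [x] := by rw [hf', fblock_append_length]
    have hg'i : fblock g.1 P'.length = l := by rw [hg', fblock_append_length]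
    rcases lt_trichotomy P'.length P.length with hk | hk | hk
    · right
      have hagree : ∀ m < P'.length, fblock f'.1 m = fblock f.1 m := fun m hm => by
        rw [hf'P m hm, hgP m (by omega), hfP m (by omega)]
      rw [hgP _ hk] at hg'i
      have hfol : ∀ u v, l = [u, v] → v < u → IsFollower f.1 P'.length := fun u v hl hlt =>
        (isFollower_congr fun m hm => hfP m (by omega)).mpr
          (hpair _ u v hk (by rw [hg'i, hl]) hlt)
      have hfk : fblock f.1 P'.length = l := by rw [hfP _ hk, hg'i]
      rcases hl with rfl | rfl
      · exact h.rel_of_singleton_pair hagree hf'i hfk (.inl rfl) (.inr le_rfl)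
      · refine h.rel_of_singleton_pair hagree hf'i hfk (.inr rfl) ?_
        rcases lt_or_ge x y with hlt | hge
        · exact .inl (hfol _ _ rfl hlt)
        · exact .inr hge
    · obtain ⟨rfl, hQ⟩ := List.append_inj (hg'.symm.trans hg) hk
      simp only [List.cons.injEq] at hQ
      obtain ⟨rfl, rfl⟩ := hQ
      simp only [List.cons.injEq, and_true] at hl
      rcases hl with ⟨rfl, rfl⟩ | ⟨rfl, rfl⟩
      · right
        refine h.rel_of_head_lt (i := P'.length) ?_ hfn (by simpa [hf'i, hfi, headL] using hab)
        intro m hm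
        rw [hf'P m hm, hgP m hm, hfP m hm]
      · left
        exact Subtype.ext (hf'.trans hf.symm)
    · right
      refine h.rel_of_head_lt (i := P.length) ?_ hfn ?_
      · intro m hm
        rw [hf'P m (by omega), hgP m hm, hfP m hm]
      · simpa [hf'P _ hk, hgi, hfi, headL] using hab
  · intro g' hg'X hface
    obtain ⟨P', Q', x, y, l, hf', hg', hl⟩ := hface.exists_split f.2.1 hg'X
    have hf'P : ∀ m < P'.length, fblock g'.1 m = fblock f.1 m := fun m hm => by
      rw [hf', hg', fblock_append_of_lt _ hm, fblock_append_of_lt _ hm]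
    have hf'i : fblock f.1 P'.length = [x] := by rw [hf', fblock_append_length]
    have hf'i' : fblock f.1 (P'.length + 1) = [y] := by rw [hf', fblock_append_length_succ]
    have hg'i : fblock g'.1 P'.length = l := by rw [hg', fblock_append_length]
    rcases lt_trichotomy P'.length P.length with hk | hk | hk
    · right
      have hagree : ∀ m < P'.length, fblock g.1 m = fblock g'.1 m := fun m hm => by
        rw [hf'P m hm, hgP m (by omega), hfP m (by omega)]
      have hgk : fblock g.1 P'.length = [x] := by rw [hgP _ hk, ← hfP _ hk, hf'i]
      have hyx : y ≤ x := by
        rw [hfP _ hk] at hf'i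
        rcases Nat.lt_or_ge (P'.length + 1) P.length with hk' | hk'
        · rw [hfP _ hk'] at hf'i'
          exact hsing _ _ _ hk' hf'i hf'i'
        · have hk'' : P'.length + 1 = P.length := by omega
          rw [hk'', hfi] at hf'i'
          simp only [List.cons.injEq, and_true] at hf'i'
          exact hf'i' ▸ hlast _ _ hk'' hf'i
      rcases hl with rfl | rfl
      · exact h.rel_of_singleton_pair hagree hgk hg'i (.inl rfl) (.inr le_rfl)
      · exact h.rel_of_singleton_pair hagree hgk hg'i (.inr rfl) (.inr hyx)
    · obtain ⟨rfl, hQ⟩ := List.append_inj (hf'.symm.trans hf) hk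
      simp only [List.cons.injEq, and_true] at hQ
      obtain ⟨rfl, rfl, rfl⟩ := hQ
      rcases hl with rfl | rfl
      · right
        refine h.rel_of_head_lt (i := P'.length) ?_ ?_ (by simpa [hg'i, hgi, headL] using hab)
        · intro m hm
          rw [hf'P m hm, hgP m hm, hfP m hm]
        · intro hfol
          refine hgn (hfol.of_subset ?_ (by simp [hg'i, hgi]))
          intro m hm
          rw [hf'P m hm, hgP m hm, hfP m hm]
      · left
        exact Subtype.ext (hg'.trans hg.symm)
    · right
      refine h.rel_of_head_lt (i := P.length) ?_ ?_ ?_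
      · intro m hm
        rw [hf'P m (by omega), hgP m hm, hfP m hm]
      · rwa [isFollower_congr (M := f.1) fun m hm => hf'P m (by omega)]
      · simpa [hf'P _ hk, hgi, hfi, headL] using hab

end Admissible

theorem stmt10 (n : ℕ) (r : SymbolOn n → SymbolOn n → Prop)
    (hr : IsStrictTotalOrder (SymbolOn n) r) (hadm : Admissible n r)
    (e : SymbolOn n) (he : Critical n r (cellSet n 2) e) :
    (∀ i a b, fblock e.1 i = [a] → fblock e.1 (i + 1) = [b] → b < a) ∧
    (∀ i a b, fblock e.1 i = [a, b] → b < a → IsFollower e.1 i) := by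
  obtain ⟨heX, hno_coface, hno_face⟩ := he
  rw [← forall_and]
  intro i
  induction i using Nat.strong_induction_on with
  | _ i ih =>
  have hsing : ∀ P R, e.1 = P ++ R → P.length = i → ∀ k x y, k + 1 < P.length →
      fblock P k = [x] → fblock P (k + 1) = [y] → y ≤ x := by
    intro P R hP hi k x y hk hx hy
    refine ((ih k (by omega)).1 x y ?_ ?_).le
    · rw [hP, fblock_append_of_lt _ (by omega), hx]
    · rw [hP, fblock_append_of_lt _ hk, hy]
  have hpair : ∀ P R, e.1 = P ++ R → P.length = i → ∀ k x y, k < P.length →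
      fblock P k = [x, y] → y < x → IsFollower P k := by
    intro P R hP hi k x y hk hx hlt
    have hfol := (ih k (by omega)).2 x y (by rw [hP, fblock_append_of_lt _ hk, hx]) hlt
    refine (isFollower_congr fun m hm => ?_).mp hfol
    rw [hP, fblock_append_of_lt _ (by omega)]
  constructor
  · intro a b ha hb
    obtain ⟨P, R, hi, hP⟩ := exists_eq_append_of_fblock_ne_nil
      (show fblock e.1 i ≠ [] by simp [ha])
    rw [ha] at hP
    obtain ⟨Q, rfl⟩ : ∃ Q, R = [b] :: Q := by
      rw [hP, ← hi, fblock_append_add] at hb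
      rcases R with _ | ⟨c, Q⟩
      · simp [fblock] at hb
      · exact ⟨Q, by simpa [fblock] using hb⟩
    by_contra hba
    have hab : a < b := lt_of_le_of_ne (not_lt.mp hba) (e.ne_of_eq_append_singletons hP)
    let g : SymbolOn n :=
      ⟨P ++ [b, a] :: Q, (isSymbolOn_append_iff n P Q a b).mp (hP ▸ e.2)⟩
    refine hno_coface g (hadm.paired hab hP rfl heX ?_ ?_ (hsing P _ hP hi) (hpair P _ hP hi))
    · intro c hc
      have hc' : c ∈ P ∨ c = [b, a] ∨ c ∈ Q := by simpa [g] using hc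
      rcases hc' with hc | rfl | hc
      · exact heX c (by simp [hP, hc])
      · simp
      · exact heX c (by simp [hP, hc])
    · rintro ⟨j, hj, x, hx, hlt⟩
      have hx' : fblock e.1 j = [x] := by
        rw [hP, fblock_append_of_lt _ (by omega), ← hx]
        exact (fblock_append_of_lt _ (by omega)).symm
      have hax := (ih j (by omega)).1 x a hx' (by rw [← hj, hi, ha])
      have hxa := hlt a (by rw [fblock_append_length]; simp)
      omega
  · intro b a hba hlt
    obtain ⟨P, Q, hi, hP⟩ := exists_eq_append_of_fblock_ne_nil
      (show fblock e.1 i ≠ [] by simp [hba])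
    rw [hba] at hP
    by_contra hfol
    let f : SymbolOn n :=
      ⟨P ++ [a] :: [b] :: Q, (isSymbolOn_append_iff n P Q a b).mpr (hP ▸ e.2)⟩
    refine hno_face f
      (hadm.paired hlt rfl hP ?_ heX (hi ▸ hfol) (hsing P _ hP hi) (hpair P _ hP hi))
    intro c hc
    have hc' : c ∈ P ∨ c = [a] ∨ c = [b] ∨ c ∈ Q := by simpa [f] using hc
    rcases hc' with hc | rfl | rfl | hc
    · exact heX c (by simp [hP, hc])
    · simp
    · simp
    · exact heX c (by simp [hP, hc])
end
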